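/- Let E be a weak almost Fraïssé (weak AF) real Banach space. Then for all finite-dimensional subspaces X, Y of E: γ_E^a(X,Y) = D_E^a(X,Y) ≤ γ_E(X,Y) ≤ D_E(X,Y). In particular γ_E^a is a pseudometric on the set of finite-dimensional subspaces of E. -/

import Mathlib

noncomputable section

/-- `φ` is a `δ`-isometry (a member of `Emb_δ(X,E)`). -/
def IsEmb {E X : Type*} [NormedAddCommGroup E] [NormedSpace ℝ E]
    [NormedAddCommGroup X] [NormedSpace ℝ X] (δ : ℝ) (φ : X →L[ℝ] E) : Prop :=
  ∀ x : X, (1 + δ)⁻¹ * ‖x‖ ≤ ‖φ x‖ ∧ ‖φ x‖ ≤ (1 + δ) * ‖x‖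

/-- `T` is a surjective `ε`-isometry of `E`. -/
def IsEpsIsom {E : Type*} [NormedAddCommGroup E] [NormedSpace ℝ E]
    (ε : ℝ) (T : E ≃L[ℝ] E) : Prop :=
  ∀ z : E, (1 + ε)⁻¹ * ‖z‖ ≤ ‖T z‖ ∧ ‖T z‖ ≤ (1 + ε) * ‖z‖

/-- The closed unit ball of a subspace `X` of `E`, viewed as a subset of `E`. -/
def ballSet {E : Type*} [NormedAddCommGroup E] [NormedSpace ℝ E]
    (X : Subspace ℝ E) : Set E :=
  {x : E | x ∈ X ∧ ‖x‖ ≤ 1}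

/-- `d_δ(X,Y) = inf { d_H(t(B_X), s(B_Y)) : t ∈ Emb_δ(X,E), s ∈ Emb_δ(Y,E) }`. -/
def dDelta {E : Type*} [NormedAddCommGroup E] [NormedSpace ℝ E]
    (δ : ℝ) (X Y : Subspace ℝ E) : ℝ :=
  sInf {r : ℝ | ∃ (t : X →L[ℝ] E) (s : Y →L[ℝ] E), IsEmb δ t ∧ IsEmb δ s ∧
    r = Metric.hausdorffDist ((fun x => t x) '' Metric.closedBall (0 : X) 1)
      ((fun y => s y) '' Metric.closedBall (0 : Y) 1)}

/-- `γ_E^a(X,Y) = sup_{δ > 0} d_δ(X,Y)`. -/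
def gammaA {E : Type*} [NormedAddCommGroup E] [NormedSpace ℝ E]
    (X Y : Subspace ℝ E) : ℝ :=
  ⨆ δ : Set.Ioi (0 : ℝ), dDelta (δ : ℝ) X Y

/-- `γ_E(X,Y) = inf { d_H(t(B_X), s(B_Y)) : t ∈ Emb_0(X,E), s ∈ Emb_0(Y,E) }`. -/
def gammaE {E : Type*} [NormedAddCommGroup E] [NormedSpace ℝ E]
    (X Y : Subspace ℝ E) : ℝ :=
  dDelta 0 X Y

/-- `D_δ(X,Y) = inf { d_H(T(B_X), U(B_Y)) : T, U ∈ Isom_δ(E) }`. -/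
def DDelta {E : Type*} [NormedAddCommGroup E] [NormedSpace ℝ E]
    (δ : ℝ) (X Y : Subspace ℝ E) : ℝ :=
  sInf {r : ℝ | ∃ T U : E ≃L[ℝ] E, IsEpsIsom δ T ∧ IsEpsIsom δ U ∧
    r = Metric.hausdorffDist ((fun z => T z) '' ballSet X) ((fun z => U z) '' ballSet Y)}

/-- `D_E^a(X,Y) = sup_{δ > 0} D_δ(X,Y)`. -/
def DistDA {E : Type*} [NormedAddCommGroup E] [NormedSpace ℝ E]
    (X Y : Subspace ℝ E) : ℝ :=
  ⨆ δ : Set.Ioi (0 : ℝ), DDelta (δ : ℝ) X Y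

/-- `D_E(X,Y) = inf { d_H(T(B_X), B_Y) : T ∈ Isom(E) }`. -/
def DistDE {E : Type*} [NormedAddCommGroup E] [NormedSpace ℝ E]
    (X Y : Subspace ℝ E) : ℝ :=
  sInf {r : ℝ | ∃ T : E ≃ₗᵢ[ℝ] E,
    r = Metric.hausdorffDist ((fun z => T z) '' ballSet X) (ballSet Y)}

/-- `E` is weak almost Fraïssé (weak AF). -/
def WeakAlmostFraisse (E : Type*) [NormedAddCommGroup E] [NormedSpace ℝ E] : Prop :=
  ∀ (X : Subspace ℝ E), FiniteDimensional ℝ X → ∀ ε > (0 : ℝ), ∃ δ > (0 : ℝ),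
    ∀ φ : X →L[ℝ] E, IsEmb δ φ →
      ∃ T : E ≃L[ℝ] E, IsEpsIsom ε T ∧ ∀ x : X, T (x : E) = φ x

section Auxiliary

open Metric

variable {E : Type*} [NormedAddCommGroup E] [NormedSpace ℝ E]

lemma IsEmb.mono {X : Type*} [NormedAddCommGroup X] [NormedSpace ℝ X] {δ ε : ℝ} (hδ : 0 ≤ δ)
    (h : δ ≤ ε) {φ : X →L[ℝ] E} (hφ : IsEmb δ φ) : IsEmb ε φ := by
  intro x
  refine ⟨le_trans ?_ (hφ x).1, (hφ x).2.trans ?_⟩ <;> gcongr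

lemma IsEpsIsom.mono {δ ε : ℝ} (hδ : 0 ≤ δ) (h : δ ≤ ε) {T : E ≃L[ℝ] E}
    (hT : IsEpsIsom δ T) : IsEpsIsom ε T := by
  intro x
  refine ⟨le_trans ?_ (hT x).1, (hT x).2.trans ?_⟩ <;> gcongr

lemma isEpsIsom_refl {δ : ℝ} (hδ : 0 ≤ δ) : IsEpsIsom δ (ContinuousLinearEquiv.refl ℝ E) := by
  refine IsEpsIsom.mono le_rfl hδ fun z => ?_
  simp

lemma IsEpsIsom.symm {δ : ℝ} (hδ : 0 ≤ δ) {T : E ≃L[ℝ] E} (hT : IsEpsIsom δ T) :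
    IsEpsIsom δ T.symm := by
  intro z
  have h := hT (T.symm z)
  rw [T.apply_symm_apply] at h
  have hpos : 0 < 1 + δ := by linarith
  exact ⟨(inv_mul_le_iff₀ hpos).2 h.2, (inv_mul_le_iff₀ hpos).1 h.1⟩

lemma IsEpsIsom.trans {δ ε : ℝ} (hδ : 0 ≤ δ) (hε : 0 ≤ ε) {T U : E ≃L[ℝ] E}
    (hT : IsEpsIsom δ T) (hU : IsEpsIsom ε U) :
    IsEpsIsom ((1 + δ) * (1 + ε) - 1) (T.trans U) := by
  intro z
  have hδ' : 0 < 1 + δ := by linarith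
  have hε' : 0 < 1 + ε := by linarith
  rw [add_sub_cancel, mul_inv]
  constructor
  · calc (1 + δ)⁻¹ * (1 + ε)⁻¹ * ‖z‖ = (1 + ε)⁻¹ * ((1 + δ)⁻¹ * ‖z‖) := by ring
      _ ≤ (1 + ε)⁻¹ * ‖T z‖ := by gcongr; exact (hT z).1
      _ ≤ ‖U (T z)‖ := (hU (T z)).1
  · calc ‖U (T z)‖ ≤ (1 + ε) * ‖T z‖ := (hU (T z)).2
      _ ≤ (1 + ε) * ((1 + δ) * ‖z‖) := by gcongr; exact (hT z).2
      _ = (1 + δ) * (1 + ε) * ‖z‖ := by ring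

lemma IsEpsIsom.isEmb_comp_subtypeL {δ : ℝ} {T : E ≃L[ℝ] E} (hT : IsEpsIsom δ T)
    (X : Subspace ℝ E) : IsEmb δ ((T : E →L[ℝ] E).comp X.subtypeL) :=
  fun x => hT x

lemma isEmb_subtypeL {δ : ℝ} (hδ : 0 ≤ δ) (X : Subspace ℝ E) : IsEmb δ X.subtypeL :=
  (isEpsIsom_refl hδ).isEmb_comp_subtypeL X

lemma image_closedBall_subspace (X : Subspace ℝ E) (f : E → E) :
    (fun x : X => f x) '' closedBall (0 : X) 1 = f '' ballSet X := by
  ext z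
  simp [ballSet, and_assoc, and_left_comm]

lemma ballSet_nonempty (X : Subspace ℝ E) : (ballSet X).Nonempty :=
  ⟨0, X.zero_mem, by simp⟩

lemma isBounded_ballSet (X : Subspace ℝ E) : Bornology.IsBounded (ballSet X) :=
  isBounded_iff_forall_norm_le.2 ⟨1, fun _ hx => hx.2⟩

lemma hausdorffEDist_image_ballSet_ne_top (X Y : Subspace ℝ E) (T U : E →L[ℝ] E) :
    hausdorffEDist (T '' ballSet X) (U '' ballSet Y) ≠ ⊤ :=
  hausdorffEDist_ne_top_of_nonempty_of_bounded ((ballSet_nonempty X).image _)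
    ((ballSet_nonempty Y).image _) (T.lipschitz.isBounded_image (isBounded_ballSet X))
    (U.lipschitz.isBounded_image (isBounded_ballSet Y))

/-- A map that expands distances by a factor at most `K` expands Hausdorff distances by a factor
at most `K`. -/
lemma hausdorffDist_image_le_of_dist_le {α β : Type*} [PseudoMetricSpace α] [PseudoMetricSpace β]
    {f : α → β} {K : ℝ} (hK : 0 ≤ K) (hf : ∀ x y, dist (f x) (f y) ≤ K * dist x y)
    {s t : Set α} {r : ℝ} (hst : hausdorffEDist s t ≠ ⊤) (hr : hausdorffDist s t < r) :
    hausdorffDist (f '' s) (f '' t) ≤ K * r := by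
  have hr0 : 0 ≤ r := hausdorffDist_nonneg.trans hr.le
  refine hausdorffDist_le_of_mem_dist (by positivity) ?_ ?_
  · rintro _ ⟨x, hx, rfl⟩
    obtain ⟨y, hy, hxy⟩ := exists_dist_lt_of_hausdorffDist_lt hx hr hst
    exact ⟨f y, ⟨y, hy, rfl⟩, (hf x y).trans (by gcongr)⟩
  · rintro _ ⟨y, hy, rfl⟩
    obtain ⟨x, hx, hxy⟩ := exists_dist_lt_of_hausdorffDist_lt' hy hr hst
    refine ⟨f x, ⟨x, hx, rfl⟩, (hf y x).trans ?_⟩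
    rw [dist_comm]
    gcongr

lemma dDelta_nonneg (δ : ℝ) (X Y : Subspace ℝ E) : 0 ≤ dDelta δ X Y := by
  refine Real.sInf_nonneg ?_
  rintro _ ⟨_, _, _, _, rfl⟩
  exact hausdorffDist_nonneg

lemma dDelta_le {δ : ℝ} {X Y : Subspace ℝ E} {t : X →L[ℝ] E} {s : Y →L[ℝ] E}
    (ht : IsEmb δ t) (hs : IsEmb δ s) :
    dDelta δ X Y ≤ hausdorffDist ((fun x => t x) '' closedBall (0 : X) 1)
      ((fun y => s y) '' closedBall (0 : Y) 1) := by
  refine csInf_le ⟨0, ?_⟩ ⟨t, s, ht, hs, rfl⟩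
  rintro _ ⟨_, _, _, _, rfl⟩
  exact hausdorffDist_nonneg

lemma le_dDelta {δ : ℝ} (hδ : 0 ≤ δ) {X Y : Subspace ℝ E} {a : ℝ}
    (h : ∀ (t : X →L[ℝ] E) (s : Y →L[ℝ] E), IsEmb δ t → IsEmb δ s →
      a ≤ hausdorffDist ((fun x => t x) '' closedBall (0 : X) 1)
        ((fun y => s y) '' closedBall (0 : Y) 1)) :
    a ≤ dDelta δ X Y := by
  refine le_csInf ⟨_, _, _, isEmb_subtypeL hδ X, isEmb_subtypeL hδ Y, rfl⟩ ?_
  rintro _ ⟨t, s, ht, hs, rfl⟩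
  exact h t s ht hs

lemma DDelta_le {δ : ℝ} {X Y : Subspace ℝ E} {T U : E ≃L[ℝ] E}
    (hT : IsEpsIsom δ T) (hU : IsEpsIsom δ U) :
    DDelta δ X Y ≤ hausdorffDist ((fun z => T z) '' ballSet X) ((fun z => U z) '' ballSet Y) := by
  refine csInf_le ⟨0, ?_⟩ ⟨T, U, hT, hU, rfl⟩
  rintro _ ⟨_, _, _, _, rfl⟩
  exact hausdorffDist_nonneg

lemma exists_lt_of_DDelta_lt {δ : ℝ} (hδ : 0 ≤ δ) {X Y : Subspace ℝ E} {r : ℝ}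
    (h : DDelta δ X Y < r) :
    ∃ T U : E ≃L[ℝ] E, IsEpsIsom δ T ∧ IsEpsIsom δ U ∧
      hausdorffDist ((fun z => T z) '' ballSet X) ((fun z => U z) '' ballSet Y) < r := by
  unfold DDelta at h
  obtain ⟨_, ⟨T, U, hT, hU, rfl⟩, hr⟩ := exists_lt_of_csInf_lt
    (by exact ⟨_, _, _, isEpsIsom_refl hδ, isEpsIsom_refl hδ, rfl⟩) h
  exact ⟨T, U, hT, hU, hr⟩

lemma dDelta_le_DDelta {δ : ℝ} (hδ : 0 ≤ δ) (X Y : Subspace ℝ E) :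
    dDelta δ X Y ≤ DDelta δ X Y := by
  refine le_csInf ⟨_, _, _, isEpsIsom_refl hδ, isEpsIsom_refl hδ, rfl⟩ ?_
  rintro _ ⟨T, U, hT, hU, rfl⟩
  rw [← image_closedBall_subspace X, ← image_closedBall_subspace Y]
  exact dDelta_le (hT.isEmb_comp_subtypeL X) (hU.isEmb_comp_subtypeL Y)

lemma dDelta_anti {δ ε : ℝ} (hδ : 0 ≤ δ) (h : δ ≤ ε) (X Y : Subspace ℝ E) :
    dDelta ε X Y ≤ dDelta δ X Y :=
  le_dDelta hδ fun _ _ ht hs => dDelta_le (ht.mono hδ h) (hs.mono hδ h)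

lemma dDelta_comm (δ : ℝ) (X Y : Subspace ℝ E) : dDelta δ X Y = dDelta δ Y X := by
  unfold dDelta
  congr 1
  ext r
  constructor <;>
  · rintro ⟨t, s, ht, hs, rfl⟩
    exact ⟨s, t, hs, ht, hausdorffDist_comm⟩

lemma bddAbove_dDelta (X Y : Subspace ℝ E) :
    BddAbove (Set.range fun δ : Set.Ioi (0 : ℝ) => dDelta (δ : ℝ) X Y) := by
  refine ⟨dDelta 0 X Y, ?_⟩
  rintro _ ⟨δ, rfl⟩
  exact dDelta_anti le_rfl (le_of_lt δ.2) X Y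

lemma bddAbove_DDelta (X Y : Subspace ℝ E) :
    BddAbove (Set.range fun δ : Set.Ioi (0 : ℝ) => DDelta (δ : ℝ) X Y) := by
  refine ⟨hausdorffDist ((fun z => ContinuousLinearEquiv.refl ℝ E z) '' ballSet X)
    ((fun z => ContinuousLinearEquiv.refl ℝ E z) '' ballSet Y), ?_⟩
  rintro _ ⟨δ, rfl⟩
  exact DDelta_le (isEpsIsom_refl (le_of_lt δ.2)) (isEpsIsom_refl (le_of_lt δ.2))

lemma DDelta_le_DistDA {δ : ℝ} (hδ : 0 < δ) (X Y : Subspace ℝ E) :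
    DDelta δ X Y ≤ DistDA X Y :=
  le_ciSup (bddAbove_DDelta X Y) (⟨δ, hδ⟩ : Set.Ioi (0 : ℝ))

lemma dDelta_le_gammaA {δ : ℝ} (hδ : 0 < δ) (X Y : Subspace ℝ E) :
    dDelta δ X Y ≤ gammaA X Y :=
  le_ciSup (bddAbove_dDelta X Y) (⟨δ, hδ⟩ : Set.Ioi (0 : ℝ))

lemma gammaA_le_DistDA (X Y : Subspace ℝ E) : gammaA X Y ≤ DistDA X Y :=
  ciSup_le fun δ => (dDelta_le_DDelta (le_of_lt δ.2) X Y).trans (DDelta_le_DistDA δ.2 X Y)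

lemma gammaA_le_gammaE (X Y : Subspace ℝ E) : gammaA X Y ≤ gammaE X Y :=
  ciSup_le fun δ => dDelta_anti le_rfl (le_of_lt δ.2) X Y

lemma gammaE_le_DistDE (X Y : Subspace ℝ E) : gammaE X Y ≤ DistDE X Y := by
  refine le_csInf ⟨_, LinearIsometryEquiv.refl ℝ E, rfl⟩ ?_
  rintro _ ⟨T, rfl⟩
  have hT : IsEpsIsom 0 T.toContinuousLinearEquiv := fun z => by simp
  have h := dDelta_le (hT.isEmb_comp_subtypeL X) (isEmb_subtypeL le_rfl Y)
  have hY : (fun y : Y => Y.subtypeL y) '' closedBall (0 : Y) 1 = ballSet Y :=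
    (image_closedBall_subspace Y id).trans (Set.image_id _)
  rw [hY] at h
  rwa [← image_closedBall_subspace X]

lemma DistDA_le_gammaA (hE : WeakAlmostFraisse E) (X Y : Subspace ℝ E)
    (hX : FiniteDimensional ℝ X) (hY : FiniteDimensional ℝ Y) : DistDA X Y ≤ gammaA X Y := by
  refine ciSup_le fun ⟨ε, hε⟩ => ?_
  obtain ⟨δ₁, hδ₁, h₁⟩ := hE X hX ε hε
  obtain ⟨δ₂, hδ₂, h₂⟩ := hE Y hY ε hε
  have hδ : 0 < min δ₁ δ₂ := lt_min hδ₁ hδ₂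
  refine le_trans (le_dDelta hδ.le fun t s ht hs => ?_) (dDelta_le_gammaA hδ X Y)
  obtain ⟨T, hT, hTt⟩ := h₁ t (ht.mono hδ.le (min_le_left _ _))
  obtain ⟨U, hU, hUs⟩ := h₂ s (hs.mono hδ.le (min_le_right _ _))
  simp_rw [← hTt, ← hUs]
  rw [image_closedBall_subspace X fun z => T z, image_closedBall_subspace Y fun z => U z]
  exact DDelta_le hT hU

lemma gammaA_self (X : Subspace ℝ E) : gammaA X X = 0 := by
  refine le_antisymm (ciSup_le fun δ => ?_) (Real.iSup_nonneg fun δ => dDelta_nonneg _ X X)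
  have hδ := isEmb_subtypeL (le_of_lt δ.2) X
  exact (dDelta_le hδ hδ).trans_eq hausdorffDist_self_zero

lemma gammaA_comm (X Y : Subspace ℝ E) : gammaA X Y = gammaA Y X := by
  simp only [gammaA, dDelta_comm _ X Y]

lemma DDelta_triangle {δ ε : ℝ} (hδ : 0 ≤ δ) (h : (1 + δ) ^ 3 ≤ 1 + ε) (X Y Z : Subspace ℝ E) :
    DDelta ε X Z ≤ DDelta δ X Y + (1 + δ) ^ 2 * DDelta δ Y Z := by
  have hδ1 : 0 ≤ 1 + δ := by linarith
  have key : ∀ a > DDelta δ X Y, ∀ b > DDelta δ Y Z, DDelta ε X Z ≤ a + (1 + δ) ^ 2 * b := by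
    intro a ha b hb
    obtain ⟨T, U, hT, hU, hTU⟩ := exists_lt_of_DDelta_lt hδ ha
    obtain ⟨V, W, hV, hW, hVW⟩ := exists_lt_of_DDelta_lt hδ hb
    have hS := (hV.symm hδ).trans hδ hδ hU
    have hnn : 0 ≤ (1 + δ) * (1 + δ) - 1 := by nlinarith
    have hWS : IsEpsIsom ε (W.trans (V.symm.trans U)) :=
      (hW.trans hδ hnn hS).mono (by nlinarith) (by linarith)
    have hTε : IsEpsIsom ε T := hT.mono hδ (by nlinarith [pow_nonneg hδ 3])
    have hdist : ∀ x y, dist (V.symm.trans U x) (V.symm.trans U y) ≤ (1 + δ) ^ 2 * dist x y := by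
      intro x y
      rw [dist_eq_norm, dist_eq_norm, ← map_sub]
      exact (hS (x - y)).2.trans_eq (by ring)
    have himage := hausdorffDist_image_le_of_dist_le (by positivity) hdist
      (hausdorffEDist_image_ballSet_ne_top Y Z V W) hVW
    simp only [Set.image_image, ContinuousLinearEquiv.coe_coe, ContinuousLinearEquiv.trans_apply,
      ContinuousLinearEquiv.symm_apply_apply] at himage
    calc DDelta ε X Z ≤ hausdorffDist ((fun z => T z) '' ballSet X)
          ((fun z => W.trans (V.symm.trans U) z) '' ballSet Z) := DDelta_le hTε hWS
      _ ≤ hausdorffDist ((fun z => T z) '' ballSet X) ((fun z => U z) '' ballSet Y) +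
          hausdorffDist ((fun z => U z) '' ballSet Y)
            ((fun z => W.trans (V.symm.trans U) z) '' ballSet Z) :=
        hausdorffDist_triangle (hausdorffEDist_image_ballSet_ne_top X Y T U)
      _ ≤ a + (1 + δ) ^ 2 * b := add_le_add hTU.le himage
  refine le_of_forall_pos_le_add fun η hη => ?_
  have hK : 0 < 1 + (1 + δ) ^ 2 := by positivity
  refine (key (DDelta δ X Y + η / (1 + (1 + δ) ^ 2)) (lt_add_of_pos_right _ (by positivity))
    (DDelta δ Y Z + η / (1 + (1 + δ) ^ 2)) (lt_add_of_pos_right _ (by positivity))).trans_eq ?_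
  field_simp
  ring

lemma DistDA_triangle (X Y Z : Subspace ℝ E) : DistDA X Z ≤ DistDA X Y + DistDA Y Z := by
  refine ciSup_le fun ⟨ε, hε⟩ => ?_
  have hε0 : (0 : ℝ) < ε := hε
  have hcont : Filter.Tendsto (fun δ : ℝ => DistDA X Y + (1 + δ) ^ 2 * DistDA Y Z)
      (nhdsWithin 0 (Set.Ioi 0)) (nhds (DistDA X Y + DistDA Y Z)) := by
    have : Continuous fun δ : ℝ => DistDA X Y + (1 + δ) ^ 2 * DistDA Y Z := by fun_prop
    simpa using (this.tendsto 0).mono_left nhdsWithin_le_nhds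
  have hsmall : ∀ᶠ δ : ℝ in nhdsWithin 0 (Set.Ioi 0), (1 + δ) ^ 3 < 1 + ε := by
    have : Continuous fun δ : ℝ => (1 + δ) ^ 3 := by fun_prop
    refine nhdsWithin_le_nhds ((this.tendsto 0).eventually_lt_const ?_)
    simpa using hε0
  refine ge_of_tendsto hcont ?_
  filter_upwards [hsmall, self_mem_nhdsWithin] with δ hδε hδ
  have hδ0 : (0 : ℝ) < δ := hδ
  refine (DDelta_triangle hδ0.le hδε.le X Y Z).trans ?_
  gcongr <;> exact DDelta_le_DistDA hδ0 _ _

end Auxiliary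


/-- If `E` is weak AF, then `γ_E^a = D_E^a ≤ γ_E ≤ D_E` on finite-dimensional subspaces,
and in particular `γ_E^a` is a pseudometric on the set of finite-dimensional subspaces. -/
theorem pseudometrics_of_weakAlmostFraisse
    (E : Type*) [NormedAddCommGroup E] [NormedSpace ℝ E] [CompleteSpace E]
    (hE : WeakAlmostFraisse E) :
    (∀ X Y : Subspace ℝ E, FiniteDimensional ℝ X → FiniteDimensional ℝ Y →
      gammaA X Y = DistDA X Y ∧ DistDA X Y ≤ gammaE X Y ∧ gammaE X Y ≤ DistDE X Y) ∧
    (∀ X : Subspace ℝ E, FiniteDimensional ℝ X → gammaA X X = 0) ∧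
    (∀ X Y : Subspace ℝ E, FiniteDimensional ℝ X → FiniteDimensional ℝ Y →
      gammaA X Y = gammaA Y X) ∧
    (∀ X Y Z : Subspace ℝ E, FiniteDimensional ℝ X → FiniteDimensional ℝ Y →
      FiniteDimensional ℝ Z → gammaA X Z ≤ gammaA X Y + gammaA Y Z) := by
  refine ⟨fun X Y hX hY => ?_, fun X _ => gammaA_self X, fun X Y _ _ => gammaA_comm X Y,
    fun X Y Z hX hY hZ => ?_⟩
  · have h := DistDA_le_gammaA hE X Y hX hY
    exact ⟨(gammaA_le_DistDA X Y).antisymm h, h.trans (gammaA_le_gammaE X Y),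
      gammaE_le_DistDE X Y⟩
  · exact (gammaA_le_DistDA X Z).trans ((DistDA_triangle X Y Z).trans
      (add_le_add (DistDA_le_gammaA hE X Y hX hY) (DistDA_le_gammaA hE Y Z hY hZ)))
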